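/- The map t ↦ J₀(t)² + Y₀(t)² is strictly decreasing on (0, ∞). -/

import Mathlib

open Real MeasureTheory Filter

/-- Bessel function of the first kind of order `n`. -/
noncomputable def besselJ (n : ℕ) (x : ℝ) : ℝ :=
  (1 / π) * ∫ θ in (0:ℝ)..π, Real.cos (n * θ - x * Real.sin θ)

/-- Bessel function of the second kind of order `n`. -/
noncomputable def besselY (n : ℕ) (x : ℝ) : ℝ :=
  (1 / π) * ∫ θ in (0:ℝ)..π, Real.sin (x * Real.sin θ - n * θ)
    - (1 / π) * ∫ t in Set.Ioi (0:ℝ),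
        (Real.exp (n * t) + (-1 : ℝ) ^ n * Real.exp (-(n : ℝ) * t)) *
          Real.exp (-x * Real.sinh t)

/-- The plane `ℝ²`. -/
abbrev Plane := EuclideanSpace ℝ (Fin 2)

/-- The fundamental solution of the 2D Helmholtz equation,
`Φ_k(x,y) = (i/4) H₀⁽¹⁾(k|x−y|)` where `H₀⁽¹⁾ = J₀ + iY₀`. -/
noncomputable def Phi (k : ℝ) (x y : Plane) : ℂ :=
  (Complex.I / 4) *
    ((besselJ 0 (k * dist x y) : ℂ) + Complex.I * (besselY 0 (k * dist x y) : ℂ))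

/-- The Laplacian of a complex-valued function on the plane,
as the sum of the pure second partial derivatives. -/
noncomputable def lap (f : Plane → ℂ) (x : Plane) : ℂ :=
  ∑ i : Fin 2,
    iteratedFDeriv ℝ 2 f x ![EuclideanSpace.single i (1:ℝ), EuclideanSpace.single i (1:ℝ)]


/-- The integrand `e^{ixu} (1-u²)^{-1/2}`. -/
noncomputable def bf (x : ℝ) (u : ℂ) : ℂ :=
  Complex.exp (Complex.I * x * u) * (1 - u ^ 2) ^ (((-1 / 2 : ℝ) : ℝ) : ℂ)

lemma bf_slit {u : ℂ} (h0 : 0 ≤ u.re) (h1 : u.re ≤ 1) (h : u.re < 1 ∨ 0 < u.im) :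
    (1 - u ^ 2) ∈ Complex.slitPlane := by
  left
  have : (1 - u ^ 2).re = 1 - u.re ^ 2 + u.im ^ 2 := by
    simp [pow_two]; ring
  rw [this]
  rcases h with h | h
  · nlinarith [sq_nonneg u.im]
  · nlinarith [sq_nonneg u.im, pow_pos h 2]

lemma bf_diff (x : ℝ) {u : ℂ} (h0 : 0 ≤ u.re) (h1 : u.re ≤ 1) (h : u.re < 1 ∨ 0 < u.im) :
    DifferentiableAt ℂ (bf x) u := by
  unfold bf
  apply DifferentiableAt.mul
  · fun_prop
  · apply DifferentiableAt.cpow_const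
    · fun_prop
    · exact bf_slit h0 h1 h

lemma bf_norm (x a s : ℝ) (h0 : 0 ≤ a) (hs : 0 < s) :
    ‖bf x (a + s * Complex.I)‖ ≤ s ^ (-1 / 2 : ℝ) * Real.exp (-x * s) := by
  unfold bf
  rw [norm_mul, Complex.norm_cpow_real, Complex.norm_exp, mul_comm]
  have e : (Complex.I * x * (a + s * Complex.I)).re = -x * s := by simp
  rw [e]
  apply mul_le_mul_of_nonneg_right _ (Real.exp_pos _).le
  apply Real.rpow_le_rpow_of_nonpos hs _ (by norm_num)
  have e2 : (1 - ((a:ℂ) + s * Complex.I) ^ 2)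
      = (1 - ((a:ℂ) + s * Complex.I)) * (1 + ((a:ℂ) + s * Complex.I)) := by ring
  rw [e2, norm_mul]
  have i1 : s ≤ ‖1 - ((a:ℂ) + s * Complex.I)‖ := by
    have := Complex.abs_im_le_norm (1 - ((a:ℂ) + s * Complex.I))
    simpa [abs_of_pos hs] using this
  have i2 : 1 ≤ ‖1 + ((a:ℂ) + s * Complex.I)‖ := by
    have := Complex.re_le_norm (1 + ((a:ℂ) + s * Complex.I))
    have h : (1 + ((a:ℂ) + s * Complex.I)).re = 1 + a := by simp
    linarith
  nlinarith

lemma bound_int {x : ℝ} (hx : 0 < x) :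
    IntegrableOn (fun s : ℝ => s ^ (-1 / 2 : ℝ) * Real.exp (-x * s)) (Set.Ioi 0) := by
  have := integrableOn_rpow_mul_exp_neg_mul_rpow (p := 1) (s := -1 / 2) (b := x)
    (by norm_num) one_pos hx
  simpa using this

lemma bf_cont (x a : ℝ) (h0 : 0 ≤ a) (h1 : a ≤ 1) :
    ContinuousOn (fun s : ℝ => bf x (a + s * Complex.I)) (Set.Ioi 0) := by
  intro s hs
  have hs : 0 < s := hs
  apply ContinuousAt.continuousWithinAt
  have h := (bf_diff x (u := a + s * Complex.I) (by simpa) (by simpa)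
    (by right; simpa)).continuousAt
  exact ContinuousAt.comp (f := fun s : ℝ => (a + s * Complex.I : ℂ)) h (by fun_prop)

lemma bf_int {x a : ℝ} (hx : 0 < x) (h0 : 0 ≤ a) (h1 : a ≤ 1) :
    IntegrableOn (fun s : ℝ => bf x (a + s * Complex.I)) (Set.Ioi 0) := by
  refine Integrable.mono' (bound_int hx)
    ((bf_cont x a h0 h1).aestronglyMeasurable measurableSet_Ioi) ?_
  filter_upwards [ae_restrict_mem measurableSet_Ioi] with s hs
  exact bf_norm x a s h0 hs

lemma contour1 {x a : ℝ} (hx : 0 < x) (h0 : 0 ≤ a) (h1 : a < 1) :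
    (∫ u in (0:ℝ)..a, bf x u) + Complex.I * (∫ s in Set.Ioi (0:ℝ), bf x (a + s * Complex.I))
      - Complex.I * (∫ s in Set.Ioi (0:ℝ), bf x ((0:ℝ) + s * Complex.I)) = 0 := by
  have hrect : ∀ R : ℝ, 0 < R →
      (∫ u in (0:ℝ)..a, bf x u) - (∫ u in (0:ℝ)..a, bf x (u + R * Complex.I))
      + Complex.I * (∫ s in (0:ℝ)..R, bf x (a + s * Complex.I))
      - Complex.I * (∫ s in (0:ℝ)..R, bf x ((0:ℝ) + s * Complex.I)) = 0 := by
    intro R hR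
    have := Complex.integral_boundary_rect_eq_zero_of_differentiableOn (bf x) 0
      (a + R * Complex.I) (by
        intro u hu
        rw [Complex.mem_reProdIm] at hu
        simp only [Complex.zero_re, Complex.zero_im, Complex.add_re, Complex.ofReal_re,
          Complex.mul_re, Complex.I_re, Complex.I_im, Complex.ofReal_im, mul_zero, mul_one,
          sub_self, add_zero, Complex.add_im, Complex.mul_im, zero_add, Set.uIcc_of_le h0,
          Set.mem_Icc] at hu
        exact (bf_diff x hu.1.1 (by linarith [hu.1.2])
          (by left; linarith [hu.1.2])).differentiableWithinAt)
    simpa using this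
  have htop : Tendsto (fun R : ℝ => ∫ u in (0:ℝ)..a, bf x (u + R * Complex.I)) atTop
      (nhds 0) := by
    have hb : Tendsto (fun R : ℝ => Real.exp (-x * R)) atTop (nhds 0) := by
      apply Real.tendsto_exp_atBot.comp
      exact tendsto_id.const_mul_atTop_of_neg (by linarith)
    apply squeeze_zero_norm' _ hb
    filter_upwards [eventually_ge_atTop 1] with R hR
    have := intervalIntegral.norm_integral_le_of_norm_le_const (a := 0) (b := a)
      (f := fun u : ℝ => bf x (u + R * Complex.I)) (C := Real.exp (-x * R)) (by
        intro u hu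
        rw [Set.uIoc_of_le h0] at hu
        refine (bf_norm x u R hu.1.le (by linarith)).trans ?_
        have : R ^ (-1 / 2 : ℝ) ≤ 1 := Real.rpow_le_one_of_one_le_of_nonpos hR (by norm_num)
        nlinarith [Real.exp_pos (-x * R)])
    refine this.trans ?_
    rw [sub_zero, abs_of_nonneg h0]
    nlinarith [Real.exp_pos (-x * R)]
  have l1 := intervalIntegral_tendsto_integral_Ioi 0 (bf_int hx h0 h1.le) tendsto_id
  have l2 := intervalIntegral_tendsto_integral_Ioi 0 (bf_int hx le_rfl zero_le_one) tendsto_id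
  have l := (((tendsto_const_nhds (x := ∫ u in (0:ℝ)..a, bf x u)).sub htop).add
    (l1.const_mul Complex.I)).sub (l2.const_mul Complex.I)
  have l' := l.congr' (f₂ := fun _ => (0:ℂ)) (by
    filter_upwards [eventually_gt_atTop 0] with R hR
    exact hrect R hR)
  have := tendsto_nhds_unique l' tendsto_const_nhds
  simpa using this

lemma bottom (x φ : ℝ) (h0 : 0 ≤ φ) (h1 : φ < π / 2) :
    ∫ u in (0:ℝ)..(Real.sin φ), bf x u
      = ∫ θ in (0:ℝ)..φ, Complex.exp (Complex.I * x * Real.sin θ) := by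
  have := intervalIntegral.integral_deriv_smul_comp'' (a := 0) (b := φ) (f := Real.sin)
    (f' := Real.cos) (g := fun u : ℝ => bf x u) (by fun_prop)
    (fun t _ => (Real.hasDerivAt_sin t).hasDerivWithinAt) (by fun_prop) (by
      rintro u ⟨θ, hθ, rfl⟩
      rw [Set.uIcc_of_le h0] at hθ
      apply ContinuousAt.continuousWithinAt
      have h := (bf_diff x (u := (Real.sin θ : ℝ))
        (by simpa only [Complex.ofReal_re] using
          Real.sin_nonneg_of_nonneg_of_le_pi hθ.1 (by linarith [hθ.2, Real.pi_pos]))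
        (by simpa only [Complex.ofReal_re] using Real.sin_le_one θ)
        (by
          left
          rw [Complex.ofReal_re, ← Real.sin_pi_div_two]
          exact Real.sin_lt_sin_of_lt_of_le_pi_div_two (by linarith [hθ.1, Real.pi_pos]) le_rfl
            (by linarith [hθ.2]))).continuousAt
      exact ContinuousAt.comp (f := fun s : ℝ => (s : ℂ)) h (by fun_prop))
  rw [Real.sin_zero] at this
  rw [← this]
  apply intervalIntegral.integral_congr
  intro θ hθ
  rw [Set.uIcc_of_le h0] at hθ
  have hc : 0 < Real.cos θ := Real.cos_pos_of_mem_Ioo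
    ⟨by linarith [hθ.1, Real.pi_pos], by linarith [hθ.2]⟩
  have e : (1 - (Real.sin θ : ℂ) ^ 2) = ((Real.cos θ ^ 2 : ℝ) : ℂ) := by
    rw [Real.cos_sq']; push_cast; ring
  have e2 : (Real.cos θ ^ 2) ^ (-1 / 2 : ℝ) = (Real.cos θ)⁻¹ := by
    rw [← Real.rpow_natCast, ← Real.rpow_mul hc.le]
    norm_num [Real.rpow_neg_one]
  simp only [Function.comp, bf]
  rw [e, ← Complex.ofReal_cpow (by positivity), e2, Complex.real_smul, mul_left_comm,
    ← Complex.ofReal_mul, mul_inv_cancel₀ hc.ne']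
  simp

lemma left_side (x : ℝ) :
    ∫ s in Set.Ioi (0:ℝ), bf x ((0:ℝ) + s * Complex.I)
      = ((∫ t in Set.Ioi (0:ℝ), Real.exp (-x * Real.sinh t) : ℝ) : ℂ) := by
  have him : Real.sinh '' Set.Ioi 0 = Set.Ioi 0 := by
    ext s
    constructor
    · rintro ⟨t, ht, rfl⟩
      exact Real.sinh_pos_iff.2 ht
    · intro hs
      exact ⟨Real.arsinh s, Real.arsinh_pos_iff.2 hs, Real.sinh_arsinh s⟩
  have := integral_image_eq_integral_deriv_smul_of_monotoneOn (s := Set.Ioi 0)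
    (f := Real.sinh) (f' := Real.cosh) measurableSet_Ioi
    (fun t _ => (Real.hasDerivAt_sinh t).hasDerivWithinAt)
    (Real.sinh_strictMono.monotone.monotoneOn _) (fun s : ℝ => bf x ((0:ℝ) + s * Complex.I))
  rw [him] at this
  rw [this, ← integral_complex_ofReal]
  congr 1
  ext t
  have hc := Real.cosh_pos t
  have e : (1 - (((0:ℝ):ℂ) + (Real.sinh t : ℂ) * Complex.I) ^ 2)
      = ((Real.cosh t ^ 2 : ℝ) : ℂ) := by
    rw [Real.cosh_sq]; push_cast; rw [zero_add, mul_pow, Complex.I_sq]; ring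
  have e2 : (Real.cosh t ^ 2) ^ (-1 / 2 : ℝ) = (Real.cosh t)⁻¹ := by
    rw [← Real.rpow_natCast, ← Real.rpow_mul hc.le]
    norm_num [Real.rpow_neg_one]
  have e3 : Complex.I * x * (((0:ℝ):ℂ) + (Real.sinh t : ℂ) * Complex.I)
      = ((-x * Real.sinh t : ℝ) : ℂ) := by
    have := Complex.I_mul_I
    push_cast
    linear_combination (x * Complex.sinh t : ℂ) * this
  simp only [bf]
  rw [e, e3, ← Complex.ofReal_cpow (by positivity), e2, Complex.real_smul, mul_left_comm,
    ← Complex.ofReal_mul, mul_inv_cancel₀ hc.ne', Complex.ofReal_exp]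
  simp

lemma contour {x : ℝ} (hx : 0 < x) :
    (∫ θ in (0:ℝ)..(π / 2), Complex.exp (Complex.I * x * Real.sin θ))
      - Complex.I * ((∫ t in Set.Ioi (0:ℝ), Real.exp (-x * Real.sinh t) : ℝ) : ℂ)
      = - Complex.I * (∫ s in Set.Ioi (0:ℝ), bf x ((1:ℝ) + s * Complex.I)) := by
  have hpi := Real.pi_pos
  have hev : ∀ᶠ φ in nhdsWithin (π / 2) (Set.Iio (π / 2)), 0 ≤ φ ∧ φ < π / 2 := by
    filter_upwards [Ioo_mem_nhdsLT (show (0:ℝ) < π / 2 by linarith)] with φ h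
    exact ⟨h.1.le, h.2⟩
  have l1 : Tendsto (fun φ : ℝ => ∫ θ in (0:ℝ)..φ, Complex.exp (Complex.I * x * Real.sin θ))
      (nhdsWithin (π / 2) (Set.Iio (π / 2)))
      (nhds (∫ θ in (0:ℝ)..(π / 2), Complex.exp (Complex.I * x * Real.sin θ))) := by
    apply Tendsto.mono_left _ nhdsWithin_le_nhds
    have : Continuous (fun φ : ℝ => ∫ θ in (0:ℝ)..φ,
        Complex.exp (Complex.I * x * Real.sin θ)) := by
      apply intervalIntegral.continuous_primitive
      intro a b
      apply Continuous.intervalIntegrable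
      fun_prop
    exact this.tendsto _
  have l2 : Tendsto (fun φ : ℝ => ∫ s in Set.Ioi (0:ℝ),
      bf x ((Real.sin φ : ℝ) + s * Complex.I))
      (nhdsWithin (π / 2) (Set.Iio (π / 2)))
      (nhds (∫ s in Set.Ioi (0:ℝ), bf x ((1:ℝ) + s * Complex.I))) := by
    apply tendsto_integral_filter_of_dominated_convergence _ _ _ (bound_int hx)
    · filter_upwards [ae_restrict_mem measurableSet_Ioi] with s hs
      have hs : 0 < s := hs
      apply Tendsto.mono_left _ nhdsWithin_le_nhds
      have h := (bf_diff x (u := (1:ℝ) + s * Complex.I) (by simp) (by simp)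
        (by right; simpa)).continuousAt
      have hh : Tendsto (fun φ : ℝ => ((Real.sin φ : ℝ) + s * Complex.I : ℂ)) (nhds (π / 2))
          (nhds ((1:ℝ) + s * Complex.I)) := by
        have : Continuous (fun φ : ℝ => ((Real.sin φ : ℝ) + s * Complex.I : ℂ)) := by fun_prop
        have := this.tendsto (π / 2)
        rwa [Real.sin_pi_div_two] at this
      exact h.tendsto.comp hh
    · filter_upwards [hev] with φ h
      exact (bf_cont x _ (Real.sin_nonneg_of_nonneg_of_le_pi h.1 (by linarith))
        (Real.sin_le_one φ)).aestronglyMeasurable measurableSet_Ioi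
    · filter_upwards [hev] with φ h
      filter_upwards [ae_restrict_mem measurableSet_Ioi] with s hs
      exact bf_norm x _ s (Real.sin_nonneg_of_nonneg_of_le_pi h.1 (by linarith)) hs
  have l := (l1.add (l2.const_mul Complex.I)).sub (tendsto_const_nhds
    (x := Complex.I * ((∫ t in Set.Ioi (0:ℝ), Real.exp (-x * Real.sinh t) : ℝ) : ℂ)))
  have l' := l.congr' (f₂ := fun _ => (0:ℂ)) (by
    filter_upwards [hev] with φ h
    rw [← bottom x φ h.1 h.2, ← left_side x]
    refine contour1 hx (Real.sin_nonneg_of_nonneg_of_le_pi h.1 (by linarith)) ?_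
    rw [← Real.sin_pi_div_two]
    exact Real.sin_lt_sin_of_lt_of_le_pi_div_two (by linarith) le_rfl h.2)
  have := tendsto_nhds_unique l' tendsto_const_nhds
  linear_combination this

lemma sym_int (g : ℝ → ℝ) (hg : Continuous g) :
    ∫ θ in (0:ℝ)..π, g (Real.sin θ) = 2 * ∫ θ in (0:ℝ)..(π / 2), g (Real.sin θ) := by
  have h := intervalIntegral.integral_comp_sub_left (a := 0) (b := π / 2)
    (fun θ => g (Real.sin θ)) π
  simp only [Real.sin_pi_sub, sub_zero] at h
  have e : π - π / 2 = π / 2 := by ring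
  rw [e] at h
  have hi : ∀ a b : ℝ, IntervalIntegrable (fun θ => g (Real.sin θ)) volume a b := fun a b =>
    (hg.comp Real.continuous_sin).intervalIntegrable _ _
  rw [← intervalIntegral.integral_add_adjacent_intervals (hi 0 (π / 2)) (hi (π / 2) π), ← h]
  ring

lemma J_eq (x : ℝ) :
    besselJ 0 x = (2 / π) * ∫ θ in (0:ℝ)..(π / 2), Real.cos (x * Real.sin θ) := by
  unfold besselJ
  simp only [Nat.cast_zero, zero_mul, zero_sub, Real.cos_neg]
  rw [sym_int (fun u => Real.cos (x * u)) (by fun_prop)]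
  ring

lemma Y_eq (x : ℝ) :
    besselY 0 x = (2 / π) * ((∫ θ in (0:ℝ)..(π / 2), Real.sin (x * Real.sin θ))
      - ∫ t in Set.Ioi (0:ℝ), Real.exp (-x * Real.sinh t)) := by
  have hpi := Real.pi_pos
  unfold besselY
  simp only [Nat.cast_zero, zero_mul, sub_zero, neg_zero, Real.exp_zero, pow_zero, one_mul]
  rw [intervalIntegral.integral_sub ((by fun_prop : Continuous
    (fun θ => Real.sin (x * Real.sin θ))).intervalIntegrable _ _) (by simp)]
  rw [sym_int (fun u => Real.sin (x * u)) (by fun_prop), integral_const_mul,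
    intervalIntegral.integral_const]
  simp only [smul_eq_mul]
  field_simp
  ring

/-- The weight on the vertical line through `1`. -/
noncomputable def bw (s : ℝ) : ℂ := (1 - ((1:ℝ) + s * Complex.I) ^ 2) ^ ((-1 / 2 : ℝ) : ℂ)

lemma bw_eq (x s : ℝ) : bf x ((1:ℝ) + s * Complex.I)
    = Complex.exp (Complex.I * x) * ((Real.exp (-x * s) : ℂ) * bw s) := by
  unfold bf bw
  rw [← mul_assoc, Complex.ofReal_exp, ← Complex.exp_add]
  congr 2
  push_cast
  linear_combination (x * s : ℂ) * Complex.I_mul_I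

lemma bw_pos {s : ℝ} (hs : 0 < s) : 0 < (bw s).re ∧ 0 < (bw s).im := by
  have hpi := Real.pi_pos
  set z : ℂ := 1 - ((1:ℝ) + s * Complex.I) ^ 2 with hz
  have hre : z.re = s ^ 2 := by simp [hz, pow_two]
  have him : z.im = -(2 * s) := by simp [hz, pow_two]; ring
  have hz0 : z ≠ 0 := by
    intro h; rw [h] at hre; simp only [Complex.zero_re] at hre; exact (pow_pos hs 2).ne hre
  have h1 : z.arg < 0 := Complex.arg_neg_iff.2 (by rw [him]; linarith)
  have h2 : |z.arg| ≤ π / 2 := Complex.abs_arg_le_pi_div_two_iff.2 (by rw [hre]; positivity)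
  have h3 := (abs_le.1 h2).1
  have e : bw s = Complex.exp (Complex.log z * ((-1 / 2 : ℝ) : ℂ)) := by
    unfold bw; rw [← hz, Complex.cpow_def_of_ne_zero hz0]
  have ei : (Complex.log z * ((-1 / 2 : ℝ) : ℂ)).im = -(z.arg / 2) := by
    rw [Complex.im_mul_ofReal, Complex.log_im]; ring
  rw [e, Complex.exp_re, Complex.exp_im, ei]
  constructor
  · exact mul_pos (Real.exp_pos _) (Real.cos_pos_of_mem_Ioo ⟨by linarith, by linarith⟩)
  · exact mul_pos (Real.exp_pos _) (Real.sin_pos_of_pos_of_lt_pi (by linarith) (by linarith))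

lemma bw_int {x : ℝ} (hx : 0 < x) :
    IntegrableOn (fun s : ℝ => (Real.exp (-x * s) : ℂ) * bw s) (Set.Ioi 0) := by
  have h := (bf_int hx zero_le_one le_rfl).const_mul (Complex.exp (-(Complex.I * x)))
  refine h.congr (Eventually.of_forall fun s => ?_)
  simp only [bw_eq]
  rw [← mul_assoc, ← Complex.exp_add]
  simp

/-- Real Laplace transforms of positive weights are positive and strictly decreasing. -/
lemma laplace_anti {r : ℝ → ℝ} (hr : ∀ s, 0 < s → 0 < r s)
    (hi : ∀ x, 0 < x → IntegrableOn (fun s => Real.exp (-x * s) * r s) (Set.Ioi 0))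
    {x y : ℝ} (hx : 0 < x) (hxy : x < y) :
    0 ≤ (∫ s in Set.Ioi (0:ℝ), Real.exp (-y * s) * r s) ∧
    (∫ s in Set.Ioi (0:ℝ), Real.exp (-y * s) * r s)
      < ∫ s in Set.Ioi (0:ℝ), Real.exp (-x * s) * r s := by
  constructor
  · apply setIntegral_nonneg measurableSet_Ioi
    intro s hs
    exact mul_nonneg (Real.exp_pos _).le (hr s hs).le
  · rw [← sub_pos, ← integral_sub (hi x hx) (hi y (hx.trans hxy))]
    have hp : ∀ s, 0 < s → 0 < Real.exp (-x * s) * r s - Real.exp (-y * s) * r s := by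
      intro s hs
      have : Real.exp (-y * s) < Real.exp (-x * s) := Real.exp_lt_exp.2 (by nlinarith)
      nlinarith [hr s hs]
    rw [setIntegral_pos_iff_support_of_nonneg_ae]
    · rw [Set.inter_eq_right.2]
      · simp
      · intro s hs
        exact (hp s hs).ne'
    · filter_upwards [ae_restrict_mem measurableSet_Ioi] with s hs
      exact (hp s hs).le
    · exact (hi x hx).sub (hi y (hx.trans hxy))

lemma cexp_int (x : ℝ) : (∫ θ in (0:ℝ)..(π / 2), Complex.exp (Complex.I * x * Real.sin θ))
    = ((∫ θ in (0:ℝ)..(π / 2), Real.cos (x * Real.sin θ) : ℝ) : ℂ)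
      + Complex.I * ((∫ θ in (0:ℝ)..(π / 2), Real.sin (x * Real.sin θ) : ℝ) : ℂ) := by
  rw [← intervalIntegral.integral_ofReal, ← intervalIntegral.integral_ofReal,
    ← intervalIntegral.integral_const_mul, ← intervalIntegral.integral_add]
  · congr 1
    ext θ
    rw [show Complex.I * x * (Real.sin θ : ℂ) = ((x * Real.sin θ : ℝ) : ℂ) * Complex.I by
      push_cast; ring, Complex.exp_mul_I, ← Complex.ofReal_cos, ← Complex.ofReal_sin]
    ring
  · apply Continuous.intervalIntegrable; fun_prop
  · apply Continuous.intervalIntegrable; fun_prop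

lemma main_eq {x : ℝ} (hx : 0 < x) :
    besselJ 0 x ^ 2 + besselY 0 x ^ 2 = (2 / π) ^ 2 *
      ((∫ s in Set.Ioi (0:ℝ), Real.exp (-x * s) * (bw s).re) ^ 2
        + (∫ s in Set.Ioi (0:ℝ), Real.exp (-x * s) * (bw s).im) ^ 2) := by
  have h := contour hx
  simp only [bw_eq] at h
  rw [cexp_int, integral_const_mul] at h
  have hre := integral_re (bw_int hx)
  have him := integral_im (bw_int hx)
  simp only [RCLike.re_to_complex, RCLike.im_to_complex, Complex.re_ofReal_mul,
    Complex.im_ofReal_mul] at hre him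
  rw [hre, him, J_eq, Y_eq]
  set V := ∫ s in Set.Ioi (0:ℝ), (Real.exp (-x * s) : ℂ) * bw s
  set A := ∫ θ in (0:ℝ)..(π / 2), Real.cos (x * Real.sin θ)
  set B := ∫ θ in (0:ℝ)..(π / 2), Real.sin (x * Real.sin θ)
  set C := ∫ t in Set.Ioi (0:ℝ), Real.exp (-x * Real.sinh t)
  have h2 := congrArg Complex.normSq h
  rw [map_mul, map_mul, Complex.normSq_neg, Complex.normSq_I, one_mul, mul_comm Complex.I (x:ℂ),
    Complex.normSq_eq_norm_sq (Complex.exp _), Complex.norm_exp_ofReal_mul_I, one_pow,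
    one_mul, Complex.normSq_apply, Complex.normSq_apply] at h2
  simp at h2
  linear_combination (2 / π) ^ 2 * h2

/-- The map `t ↦ J₀(t)² + Y₀(t)²` is strictly decreasing on `(0,∞)`. -/
theorem strictAntiOn_J0_sq_add_Y0_sq :
    StrictAntiOn (fun t : ℝ => besselJ 0 t ^ 2 + besselY 0 t ^ 2) (Set.Ioi 0) := by
  intro x hx y hy hxy
  have hx : 0 < x := hx
  have hy : 0 < y := hy
  simp only
  rw [main_eq hx, main_eq hy]
  have hR := laplace_anti (r := fun s => (bw s).re) (fun s hs => (bw_pos hs).1)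
    (fun x hx => by
      simpa only [IntegrableOn, RCLike.re_to_complex, Complex.re_ofReal_mul] using (bw_int hx).re) hx hxy
  have hI := laplace_anti (r := fun s => (bw s).im) (fun s hs => (bw_pos hs).2)
    (fun x hx => by
      simpa only [IntegrableOn, RCLike.im_to_complex, Complex.im_ofReal_mul] using (bw_int hx).im) hx hxy
  have h1 := pow_lt_pow_left₀ hR.2 hR.1 two_ne_zero
  have h2 := pow_lt_pow_left₀ hI.2 hI.1 two_ne_zero
  have hpi := Real.pi_pos
  exact mul_lt_mul_of_pos_left (add_lt_add h1 h2) (by positivity)
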